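/- Let d ∈ ℕ, m ∈ {0,1,2,3}, and let c₀ = c₁ = 1 ≤ c₂ ≤ c₃ be real constants. Let p¹,…,p^d be probability kernels on [0,1] such that for every k ∈ {1,…,d}, every m' ∈ {0,…,m}, and every φ ∈ C^{m'}([0,1],ℝ) the function z ↦ ∫ φ(y) p^k(z,dy) belongs to C^{m'}([0,1],ℝ) and satisfies ‖z ↦ ∫ φ(y) p^k(z,dy)‖_{C^{m'}} ≤ c_{m'} ‖φ‖_{C^{m'}}. Define (T²f)(x) := ∫ f(y) ⊗_{k=1}^d p^k(x_k,dy_k) for f ∈ C([0,1]^d,ℝ), where the integral is with respect to the product measure ⊗_{k=1}^d p^k(x_k,·). Then for every f ∈ C^m([0,1]^d,ℝ) it holds that T²f ∈ C^m([0,1]^d,ℝ) and ‖T²f‖_{C^m} ≤ c_m ‖f‖_{C^m}. -/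

import Mathlib

open MeasureTheory Filter

noncomputable section

/-- The unit cube `[0,1]^d` in `ℝ^d`. -/
def cube (d : ℕ) : Set (Fin d → ℝ) := Set.univ.pi fun _ => Set.Icc (0:ℝ) 1

/-- Partial derivative in coordinate `i` (within `[0,1]`, i.e. one-sided at the boundary). -/
def pd (d : ℕ) (i : Fin d) (g : (Fin d → ℝ) → ℝ) : (Fin d → ℝ) → ℝ :=
  fun x => derivWithin (fun t => g (Function.update x i t)) (Set.Icc (0:ℝ) 1) (x i)

/-- Iterated partial derivative `∂^α` (coordinates applied in a fixed order). -/
def mderiv (d : ℕ) (α : Fin d → ℕ) (f : (Fin d → ℝ) → ℝ) : (Fin d → ℝ) → ℝ :=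
  List.foldr (fun i g => (pd d i)^[α i] g) f (List.finRange d)

/-- `f ∈ C^m([0,1]^d, ℝ)`: all partial derivatives of order `0` through `m` exist
(one-sidedly at the boundary) and are continuous on the cube. -/
def MemCm (d : ℕ) : ℕ → ((Fin d → ℝ) → ℝ) → Prop
  | 0, f => ContinuousOn f (cube d)
  | m + 1, f => ContinuousOn f (cube d) ∧ ∀ i : Fin d,
      (∀ x ∈ cube d, DifferentiableWithinAt ℝ (fun t => f (Function.update x i t))
        (Set.Icc (0:ℝ) 1) (x i)) ∧
      MemCm d m (pd d i f)

/-- Sup norm over the cube: `‖g‖_∞ = sup_{x ∈ [0,1]^d} |g(x)|`. -/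
def supCube (d : ℕ) (g : (Fin d → ℝ) → ℝ) : ℝ := ⨆ x : cube d, |g x.1|

/-- The `C^m`-norm: `max_{|α| ≤ m} sup_{x ∈ [0,1]^d} |∂^α f(x)|`. -/
def CmNorm (d m : ℕ) (f : (Fin d → ℝ) → ℝ) : ℝ :=
  ⨆ α : {α : Fin d → ℕ // (∑ i, α i) ≤ m}, supCube d (mderiv d α.1 f)

/-- `λ_m := max_{0 < |α| ≤ m} ∑_i ‖∂^α b_i‖_∞`. -/
def lamNorm (d m : ℕ) (b : Fin d → (Fin d → ℝ) → ℝ) : ℝ :=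
  ⨆ α : {α : Fin d → ℕ // 0 < (∑ i, α i) ∧ (∑ i, α i) ≤ m},
    ∑ i, supCube d (mderiv d α.1 (b i))

/-- One-sided derivative within `[0,1]` for a one-dimensional function. -/
noncomputable def dI (φ : ℝ → ℝ) : ℝ → ℝ := fun z => derivWithin φ (Set.Icc (0:ℝ) 1) z

/-- `φ ∈ C^m([0,1], ℝ)`: derivatives of order `0` through `m` exist
(one-sidedly at the boundary) and are continuous on `[0,1]`. -/
def MemC1d : ℕ → (ℝ → ℝ) → Prop
  | 0, φ => ContinuousOn φ (Set.Icc (0:ℝ) 1)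
  | m + 1, φ => ContinuousOn φ (Set.Icc (0:ℝ) 1) ∧
      (∀ z ∈ Set.Icc (0:ℝ) 1, DifferentiableWithinAt ℝ φ (Set.Icc (0:ℝ) 1) z) ∧
      MemC1d m (dI φ)

/-- The `C^m`-norm of a one-dimensional function: `max_{k ≤ m} sup_{z ∈ [0,1]} |φ^{(k)}(z)|`. -/
noncomputable def C1dNorm (m : ℕ) (φ : ℝ → ℝ) : ℝ :=
  ⨆ k : Fin (m + 1), ⨆ z : Set.Icc (0:ℝ) 1, |dI^[(k : ℕ)] φ z.1|

/-- `PEC d [i₁, …, i_n] g` means: the successive partial derivatives of `g` in the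
coordinates `i₁, …, i_n` (in this order, one-sided at the boundary) exist at every point
of the cube, and the final `n`-th order partial derivative is continuous on the cube. -/
def PEC (d : ℕ) : List (Fin d) → ((Fin d → ℝ) → ℝ) → Prop
  | [], g => ContinuousOn g (cube d)
  | i :: L, g => (∀ x ∈ cube d, DifferentiableWithinAt ℝ
      (fun t => g (Function.update x i t)) (Set.Icc (0:ℝ) 1) (x i)) ∧
      PEC d L (pd d i g)

section CoordinateSlices

variable {d : ℕ}

/-- The restriction of `f` to the line through `x` in coordinate direction `k`. -/
def coordSlice (k : Fin d) (x : Fin d → ℝ) (f : (Fin d → ℝ) → ℝ) : ℝ → ℝ :=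
  fun t => f (Function.update x k t)

lemma update_mem_cube {x : Fin d → ℝ} (hx : x ∈ cube d) (k : Fin d) {t : ℝ}
    (ht : t ∈ Set.Icc (0:ℝ) 1) : Function.update x k t ∈ cube d := by
  intro i _
  by_cases h : i = k
  · subst h; simpa using ht
  · simpa [h] using hx i trivial

lemma mem_Icc_of_mem_cube {x : Fin d → ℝ} (hx : x ∈ cube d) (k : Fin d) :
    x k ∈ Set.Icc (0:ℝ) 1 := hx k trivial

lemma isCompact_cube : IsCompact (cube d) := isCompact_univ_pi fun _ => isCompact_Icc

lemma measurableSet_cube : MeasurableSet (cube d) :=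
  MeasurableSet.univ_pi fun _ => measurableSet_Icc

lemma zero_mem_cube : (0 : Fin d → ℝ) ∈ cube d := fun _ _ => by simp

lemma dist_update_update_le (x y : Fin d → ℝ) (k : Fin d) (t : ℝ) :
    dist (Function.update x k t) (Function.update y k t) ≤ dist x y := by
  refine (dist_pi_le_iff dist_nonneg).2 fun i => ?_
  by_cases h : i = k
  · subst h; simp
  · simpa [h] using dist_le_pi_dist x y i

lemma dist_update_self_le (x : Fin d → ℝ) (k : Fin d) (t : ℝ) :
    dist (Function.update x k t) x ≤ |t - x k| := by
  refine (dist_pi_le_iff (abs_nonneg _)).2 fun i => ?_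
  by_cases h : i = k
  · subst h; simp [Real.dist_eq]
  · simp [h]

@[simp] lemma coordSlice_apply_self (k : Fin d) (x : Fin d → ℝ) (f : (Fin d → ℝ) → ℝ) :
    coordSlice k x f (x k) = f x := by
  simp [coordSlice]

lemma coordSlice_pd (k : Fin d) (x : Fin d → ℝ) (f : (Fin d → ℝ) → ℝ) :
    coordSlice k x (pd d k f) = dI (coordSlice k x f) := by
  funext t
  simp only [coordSlice, pd, dI, Function.update_idem, Function.update_self]
  rfl

lemma coordSlice_pd_iterate (k : Fin d) (x : Fin d → ℝ) (b : ℕ) (f : (Fin d → ℝ) → ℝ) :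
    coordSlice k x ((pd d k)^[b] f) = dI^[b] (coordSlice k x f) := by
  induction b generalizing f with
  | zero => rfl
  | succ b ih => rw [Function.iterate_succ_apply, Function.iterate_succ_apply, ih, coordSlice_pd]

lemma continuousOn_coordSlice {f : (Fin d → ℝ) → ℝ} (hf : ContinuousOn f (cube d))
    (k : Fin d) {x : Fin d → ℝ} (hx : x ∈ cube d) :
    ContinuousOn (coordSlice k x f) (Set.Icc (0:ℝ) 1) := by
  refine hf.comp (t := cube d) ?_ fun t ht => update_mem_cube hx k ht
  exact (Continuous.update (f := fun _ : ℝ => x) continuous_const k continuous_id).continuousOn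

lemma pd_congr {f g : (Fin d → ℝ) → ℝ} (h : Set.EqOn f g (cube d)) (i : Fin d) :
    Set.EqOn (pd d i f) (pd d i g) (cube d) := fun _ hx =>
  derivWithin_congr (fun _ ht => h (update_mem_cube hx i ht))
    (h (update_mem_cube hx i (mem_Icc_of_mem_cube hx i)))

lemma pd_iterate_congr {f g : (Fin d → ℝ) → ℝ} (h : Set.EqOn f g (cube d)) (i : Fin d) (b : ℕ) :
    Set.EqOn ((pd d i)^[b] f) ((pd d i)^[b] g) (cube d) := by
  induction b generalizing f g with
  | zero => exact h
  | succ b ih => exact ih (pd_congr h i)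

lemma MemCm.continuousOn {n : ℕ} {f : (Fin d → ℝ) → ℝ} (hf : MemCm d n f) :
    ContinuousOn f (cube d) := by
  cases n with
  | zero => exact hf
  | succ n => exact hf.1

lemma MemCm.congr {n : ℕ} {f g : (Fin d → ℝ) → ℝ} (hf : MemCm d n f)
    (h : Set.EqOn f g (cube d)) : MemCm d n g := by
  induction n generalizing f g with
  | zero => exact ContinuousOn.congr hf h.symm
  | succ n ih =>
    refine ⟨hf.1.congr h.symm, fun i => ⟨fun x hx => ?_, ih (hf.2 i).2 (pd_congr h i)⟩⟩
    exact ((hf.2 i).1 x hx).congr (fun t ht => (h (update_mem_cube hx i ht)).symm)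
      (h (update_mem_cube hx i (mem_Icc_of_mem_cube hx i))).symm

lemma MemCm.of_succ {n : ℕ} {f : (Fin d → ℝ) → ℝ} (hf : MemCm d (n + 1) f) : MemCm d n f := by
  induction n generalizing f with
  | zero => exact hf.1
  | succ n ih => exact ⟨hf.1, fun i => ⟨(hf.2 i).1, ih (hf.2 i).2⟩⟩

lemma MemCm.mono {n n' : ℕ} (h : n' ≤ n) {f : (Fin d → ℝ) → ℝ} (hf : MemCm d n f) :
    MemCm d n' f := by
  induction h with
  | refl => exact hf
  | step _ ih => exact ih hf.of_succ

lemma MemCm.partial_deriv {n : ℕ} {f : (Fin d → ℝ) → ℝ} (hf : MemCm d (n + 1) f) (i : Fin d) :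
    MemCm d n (pd d i f) := (hf.2 i).2

lemma MemCm.partial_deriv_iterate {n b : ℕ} {f : (Fin d → ℝ) → ℝ} (hf : MemCm d (n + b) f) (i : Fin d) :
    MemCm d n ((pd d i)^[b] f) := by
  induction b generalizing f with
  | zero => exact hf
  | succ b ih => exact ih (MemCm.partial_deriv hf i)

lemma MemCm.differentiableOn_coordSlice {n : ℕ} {f : (Fin d → ℝ) → ℝ} (hf : MemCm d (n + 1) f)
    (i : Fin d) {x : Fin d → ℝ} (hx : x ∈ cube d) :
    DifferentiableOn ℝ (coordSlice i x f) (Set.Icc (0:ℝ) 1) := by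
  intro t ht
  have h := (hf.2 i).1 _ (update_mem_cube hx i ht)
  simp only [Function.update_idem, Function.update_self] at h
  exact h

lemma MemCm.memC1d_coordSlice {n : ℕ} {f : (Fin d → ℝ) → ℝ} (hf : MemCm d n f)
    (k : Fin d) {x : Fin d → ℝ} (hx : x ∈ cube d) : MemC1d n (coordSlice k x f) := by
  induction n generalizing f with
  | zero => exact continuousOn_coordSlice hf k hx
  | succ n ih =>
    refine ⟨continuousOn_coordSlice hf.1 k hx, hf.differentiableOn_coordSlice k hx, ?_⟩
    rw [← coordSlice_pd]
    exact ih (hf.partial_deriv k)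

end CoordinateSlices

section SymmetryOfPartials

lemma exists_sub_eq_mul_dI {φ : ℝ → ℝ} (hφ : DifferentiableOn ℝ φ (Set.Icc (0:ℝ) 1)) {s t : ℝ}
    (hs : s ∈ Set.Icc (0:ℝ) 1) (ht : t ∈ Set.Icc (0:ℝ) 1) :
    ∃ ξ ∈ Set.Icc (0:ℝ) 1, |ξ - s| ≤ |t - s| ∧ φ t - φ s = (t - s) * dI φ ξ := by
  have key : ∀ a b : ℝ, a ∈ Set.Icc (0:ℝ) 1 → b ∈ Set.Icc (0:ℝ) 1 → a < b →
      ∃ ξ ∈ Set.Ioo a b, φ b - φ a = (b - a) * dI φ ξ := by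
    intro a b ha hb hab
    obtain ⟨ξ, hξ, h⟩ := exists_hasDerivAt_eq_slope φ (dI φ) hab
      (hφ.continuousOn.mono (Set.Icc_subset_Icc ha.1 hb.2)) (fun z hz => by
        have hz' : Set.Icc (0:ℝ) 1 ∈ nhds z :=
          Icc_mem_nhds (ha.1.trans_lt hz.1) (hz.2.trans_le hb.2)
        exact (hφ z (mem_of_mem_nhds hz')).hasDerivWithinAt.hasDerivAt hz')
    refine ⟨ξ, hξ, ?_⟩
    have : b - a ≠ 0 := by linarith
    rw [h]; field_simp
  rcases lt_trichotomy s t with h | h | h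
  · obtain ⟨ξ, hξ, e⟩ := key s t hs ht h
    refine ⟨ξ, ⟨by linarith [hs.1, hξ.1], by linarith [ht.2, hξ.2]⟩, ?_, e⟩
    rw [abs_of_pos (by linarith [hξ.1]), abs_of_pos (by linarith)]
    linarith [hξ.2]
  · subst h
    exact ⟨s, hs, le_rfl, by simp⟩
  · obtain ⟨ξ, hξ, e⟩ := key t s ht hs h
    refine ⟨ξ, ⟨by linarith [ht.1, hξ.1], by linarith [hs.2, hξ.2]⟩, ?_, by linarith⟩
    rw [abs_of_neg (by linarith [hξ.2]), abs_of_neg (by linarith)]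
    linarith [hξ.1]

lemma exists_mem_Icc_ne_abs_sub_lt {a δ : ℝ} (ha : a ∈ Set.Icc (0:ℝ) 1) (hδ : 0 < δ) :
    ∃ s ∈ Set.Icc (0:ℝ) 1, s ≠ a ∧ |s - a| < δ := by
  obtain ⟨h0, h1⟩ := ha
  have hr : 0 < min (δ / 2) (1 / 2) := by positivity
  have hr1 := min_le_left (δ / 2) (1 / 2)
  have hr2 := min_le_right (δ / 2) (1 / 2)
  rcases le_total a (1 / 2) with h | h
  · refine ⟨a + min (δ / 2) (1 / 2), ⟨by linarith, by linarith⟩, by linarith, ?_⟩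
    rw [add_sub_cancel_left, abs_of_pos hr]; linarith
  · refine ⟨a - min (δ / 2) (1 / 2), ⟨by linarith, by linarith⟩, by linarith, ?_⟩
    rw [sub_sub_cancel_left, abs_neg, abs_of_pos hr]; linarith

variable {d : ℕ}

lemma exists_second_difference_eq {f : (Fin d → ℝ) → ℝ} (hf : MemCm d 2 f) {i j : Fin d}
    (hij : i ≠ j) {x : Fin d → ℝ} (hx : x ∈ cube d) {s t : ℝ} (hs : s ∈ Set.Icc (0:ℝ) 1)
    (ht : t ∈ Set.Icc (0:ℝ) 1) :
    ∃ y ∈ cube d, dist y x ≤ max |s - x i| |t - x j| ∧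
      f (Function.update (Function.update x i s) j t) - f (Function.update x i s)
        - f (Function.update x j t) + f x = (s - x i) * (t - x j) * pd d j (pd d i f) y := by
  have hxt := update_mem_cube hx j ht
  have hd1 := hf.differentiableOn_coordSlice i hxt
  have hd0 := hf.differentiableOn_coordSlice i hx
  obtain ⟨ξ, hξ, hξs, e⟩ := exists_sub_eq_mul_dI (hd1.sub hd0) (mem_Icc_of_mem_cube hx i) hs
  have hxξ := update_mem_cube hx i hξ
  obtain ⟨η, hη, hηt, e'⟩ := exists_sub_eq_mul_dI
    ((hf.partial_deriv i).differentiableOn_coordSlice j hxξ) (mem_Icc_of_mem_cube hx j) ht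
  refine ⟨Function.update (Function.update x i ξ) j η, update_mem_cube hxξ j hη, ?_, ?_⟩
  · refine (dist_pi_le_iff (le_max_of_le_left (abs_nonneg _))).2 fun l => ?_
    by_cases hl : l = j
    · subst hl; simpa [Real.dist_eq] using Or.inr hηt
    · by_cases hl' : l = i
      · subst hl'; simpa [Real.dist_eq, hl] using Or.inl hξs
      · simp [hl, hl']
  · have h1 : dI (coordSlice i (Function.update x j t) f - coordSlice i x f) ξ
        = coordSlice j (Function.update x i ξ) (pd d i f) t
          - coordSlice j (Function.update x i ξ) (pd d i f) (x j) := by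
      have : dI (coordSlice i (Function.update x j t) f - coordSlice i x f) ξ
          = dI (coordSlice i (Function.update x j t) f) ξ - dI (coordSlice i x f) ξ :=
        derivWithin_sub (hd1 ξ hξ) (hd0 ξ hξ)
      rw [this, ← coordSlice_pd, ← coordSlice_pd]
      have h2 : Function.update (Function.update x i ξ) j (x j) = Function.update x i ξ := by
        rw [Function.update_comm hij, Function.update_eq_self]
      simp only [coordSlice]
      rw [h2, Function.update_comm hij]
    rw [h1, e', ← coordSlice_pd] at e
    have h3 : Function.update (Function.update x j t) i (x i) = Function.update x j t := by
      rw [Function.update_comm hij.symm, Function.update_eq_self]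
    simp only [coordSlice, Pi.sub_apply, h3, Function.update_eq_self] at e
    rw [Function.update_comm hij, mul_assoc, ← e]
    ring

/-- Schwarz's theorem on the closed cube. -/
lemma pd_comm {f : (Fin d → ℝ) → ℝ} (hf : MemCm d 2 f) (i j : Fin d) :
    Set.EqOn (pd d i (pd d j f)) (pd d j (pd d i f)) (cube d) := by
  intro x hx
  by_cases hij : i = j
  · rw [hij]
  refine eq_of_forall_dist_le fun ε hε => ?_
  obtain ⟨δ₁, hδ₁, h₁⟩ := Metric.continuousOn_iff.1 ((hf.partial_deriv j).partial_deriv i).continuousOn x hx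
    (ε / 2) (by positivity)
  obtain ⟨δ₂, hδ₂, h₂⟩ := Metric.continuousOn_iff.1 ((hf.partial_deriv i).partial_deriv j).continuousOn x hx
    (ε / 2) (by positivity)
  have hδ : 0 < min δ₁ δ₂ := lt_min hδ₁ hδ₂
  obtain ⟨s, hs, hsne, hsd⟩ := exists_mem_Icc_ne_abs_sub_lt (mem_Icc_of_mem_cube hx i) hδ
  obtain ⟨t, ht, htne, htd⟩ := exists_mem_Icc_ne_abs_sub_lt (mem_Icc_of_mem_cube hx j) hδ
  obtain ⟨y, hy, hyd, e⟩ := exists_second_difference_eq hf hij hx hs ht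
  obtain ⟨y', hy', hyd', e'⟩ := exists_second_difference_eq hf (Ne.symm hij) hx ht hs
  have hyd2 : dist y x < δ₂ := hyd.trans_lt ((max_lt hsd htd).trans_le (min_le_right _ _))
  have hyd1 : dist y' x < δ₁ := hyd'.trans_lt ((max_lt htd hsd).trans_le (min_le_left _ _))
  have heq : pd d i (pd d j f) y' = pd d j (pd d i f) y := by
    have hne : (s - x i) * (t - x j) ≠ 0 := mul_ne_zero (sub_ne_zero.2 hsne) (sub_ne_zero.2 htne)
    apply mul_left_cancel₀ hne
    rw [← e, mul_comm (s - x i), ← e', Function.update_comm hij]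
    ring
  have a1 := h₁ y' hy' hyd1
  have a2 := h₂ y hy hyd2
  rw [heq, dist_comm] at a1
  linarith [dist_triangle (pd d i (pd d j f) x) (pd d j (pd d i f) y) (pd d j (pd d i f) x)]

lemma pd_pd_iterate_comm {b : ℕ} {f : (Fin d → ℝ) → ℝ} (hf : MemCm d (b + 1) f) (i k : Fin d) :
    Set.EqOn (pd d i ((pd d k)^[b] f)) ((pd d k)^[b] (pd d i f)) (cube d) := by
  induction b generalizing f with
  | zero => exact fun _ _ => rfl
  | succ b ih =>
    exact (ih (hf.partial_deriv k)).trans (pd_iterate_congr (pd_comm (hf.mono (by omega)) i k) k b)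

lemma pd_iterate_comm {a b : ℕ} {f : (Fin d → ℝ) → ℝ} (hf : MemCm d (a + b) f) (i k : Fin d) :
    Set.EqOn ((pd d i)^[a] ((pd d k)^[b] f)) ((pd d k)^[b] ((pd d i)^[a] f)) (cube d) := by
  induction a generalizing f with
  | zero => exact fun _ _ => rfl
  | succ a ih =>
    refine (pd_iterate_congr (pd_pd_iterate_comm (hf.mono (by omega)) i k) i a).trans ?_
    exact ih (MemCm.partial_deriv (hf.mono (by omega)) i)

end SymmetryOfPartials

section OneDimensional

lemma dI_congr {φ ψ : ℝ → ℝ} (h : Set.EqOn φ ψ (Set.Icc 0 1)) :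
    Set.EqOn (dI φ) (dI ψ) (Set.Icc 0 1) := fun _ hz => derivWithin_congr h (h hz)

lemma dI_iterate_congr {φ ψ : ℝ → ℝ} (h : Set.EqOn φ ψ (Set.Icc 0 1)) (b : ℕ) :
    Set.EqOn (dI^[b] φ) (dI^[b] ψ) (Set.Icc 0 1) := by
  induction b generalizing φ ψ with
  | zero => exact h
  | succ b ih => exact ih (dI_congr h)

lemma MemC1d.continuousOn {n : ℕ} {φ : ℝ → ℝ} (hφ : MemC1d n φ) :
    ContinuousOn φ (Set.Icc 0 1) := by
  cases n with
  | zero => exact hφ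
  | succ n => exact hφ.1

lemma MemC1d.congr {n : ℕ} {φ ψ : ℝ → ℝ} (hφ : MemC1d n φ) (h : Set.EqOn φ ψ (Set.Icc 0 1)) :
    MemC1d n ψ := by
  induction n generalizing φ ψ with
  | zero => exact ContinuousOn.congr hφ h.symm
  | succ n ih =>
    exact ⟨hφ.1.congr h.symm, fun z hz => (hφ.2.1 z hz).congr h.symm (h hz).symm,
      ih hφ.2.2 (dI_congr h)⟩

lemma MemC1d.iterate {n b : ℕ} {φ : ℝ → ℝ} (hφ : MemC1d (n + b) φ) : MemC1d n (dI^[b] φ) := by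
  induction b generalizing φ with
  | zero => exact hφ
  | succ b ih => exact ih hφ.2.2

lemma MemC1d.continuousOn_iterate {n b : ℕ} (hb : b ≤ n) {φ : ℝ → ℝ} (hφ : MemC1d n φ) :
    ContinuousOn (dI^[b] φ) (Set.Icc 0 1) := by
  obtain ⟨l, rfl⟩ := Nat.exists_eq_add_of_le' hb
  exact hφ.iterate.continuousOn

lemma dI_add_mul {φ ψ : ℝ → ℝ} (hφ : DifferentiableOn ℝ φ (Set.Icc 0 1))
    (hψ : DifferentiableOn ℝ ψ (Set.Icc 0 1)) (r : ℝ) :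
    Set.EqOn (fun z => dI φ z + r * dI ψ z) (dI fun z => φ z + r * ψ z) (Set.Icc 0 1) :=
  fun z hz => (((hφ z hz).hasDerivWithinAt.add
    ((hψ z hz).hasDerivWithinAt.const_mul r)).derivWithin (uniqueDiffOn_Icc zero_lt_one z hz)).symm

lemma MemC1d.add_mul {n : ℕ} {φ ψ : ℝ → ℝ} (hφ : MemC1d n φ) (hψ : MemC1d n ψ) (r : ℝ) :
    MemC1d n fun z => φ z + r * ψ z := by
  induction n generalizing φ ψ with
  | zero => exact ContinuousOn.add hφ (continuousOn_const.mul hψ)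
  | succ n ih =>
    exact ⟨hφ.1.add (continuousOn_const.mul hψ.1),
      fun z hz => (hφ.2.1 z hz).add ((hψ.2.1 z hz).const_mul r),
      (ih hφ.2.2 hψ.2.2).congr (dI_add_mul hφ.2.1 hψ.2.1 r)⟩

lemma dI_iterate_add_mul {n : ℕ} {φ ψ : ℝ → ℝ} (hφ : MemC1d n φ) (hψ : MemC1d n ψ) (r : ℝ)
    {b : ℕ} (hb : b ≤ n) : Set.EqOn (dI^[b] fun z => φ z + r * ψ z)
      (fun z => dI^[b] φ z + r * dI^[b] ψ z) (Set.Icc 0 1) := by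
  induction b generalizing n φ ψ with
  | zero => exact fun _ _ => rfl
  | succ b ih =>
    obtain ⟨n, rfl⟩ : ∃ l, n = l + 1 := ⟨n - 1, by omega⟩
    exact (dI_iterate_congr (dI_add_mul hφ.2.1 hψ.2.1 r) b).symm.trans
      (ih hφ.2.2 hψ.2.2 (by omega))

end OneDimensional

section KernelOperator

/-- Markov kernels on `[0,1]` acting on `C^{m'}([0,1])` with norm at most `c m'` for `m' ≤ m`. -/
structure IsCmKernel (m : ℕ) (c : ℕ → ℝ) (q : ℝ → Measure ℝ) : Prop where
  isProbabilityMeasure : ∀ z, IsProbabilityMeasure (q z)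
  measure_compl : ∀ z, q z (Set.Icc (0:ℝ) 1)ᶜ = 0
  const_nonneg : ∀ m' ≤ m, 0 ≤ c m'
  maps_to : ∀ m' ≤ m, ∀ φ : ℝ → ℝ, MemC1d m' φ → MemC1d m' (fun z => ∫ y, φ y ∂ q z)
  norm_le : ∀ m' ≤ m, ∀ φ : ℝ → ℝ, MemC1d m' φ →
    C1dNorm m' (fun z => ∫ y, φ y ∂ q z) ≤ c m' * C1dNorm m' φ

/-- The action of a kernel on functions of one variable. -/
def kernelInt (q : ℝ → Measure ℝ) (φ : ℝ → ℝ) : ℝ → ℝ := fun z => ∫ y, φ y ∂ q z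

variable {m : ℕ} {c : ℕ → ℝ} {q : ℝ → Measure ℝ}

lemma IsCmKernel.ae_mem (hq : IsCmKernel m c q) (z : ℝ) :
    ∀ᵐ y ∂ q z, y ∈ Set.Icc (0:ℝ) 1 := mem_ae_iff.2 (hq.measure_compl z)

lemma IsCmKernel.integrable (hq : IsCmKernel m c q) {φ : ℝ → ℝ}
    (hφ : ContinuousOn φ (Set.Icc 0 1)) (z : ℝ) : Integrable φ (q z) := by
  have := hq.isProbabilityMeasure z
  have h : IntegrableOn φ (Set.Icc 0 1) (q z) := hφ.integrableOn_compact isCompact_Icc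
  rwa [IntegrableOn, Measure.restrict_eq_self_of_ae_mem (hq.ae_mem z)] at h

lemma IsCmKernel.kernelInt_add_mul (hq : IsCmKernel m c q) {φ ψ : ℝ → ℝ}
    (hφ : ContinuousOn φ (Set.Icc 0 1)) (hψ : ContinuousOn ψ (Set.Icc 0 1)) (r : ℝ) :
    kernelInt q (fun y => φ y + r * ψ y) = fun z => kernelInt q φ z + r * kernelInt q ψ z := by
  funext z
  simp only [kernelInt]
  rw [integral_add (hq.integrable hφ z) ((hq.integrable hψ z).const_mul r), integral_const_mul]

lemma abs_dI_iterate_le_C1dNorm {n a : ℕ} (ha : a ≤ n) {φ : ℝ → ℝ} (hφ : MemC1d n φ) {z : ℝ}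
    (hz : z ∈ Set.Icc (0:ℝ) 1) : |dI^[a] φ z| ≤ C1dNorm n φ := by
  have hb : BddAbove (Set.range fun z : Set.Icc (0:ℝ) 1 => |dI^[a] φ z.1|) := by
    obtain ⟨C, hC⟩ := isCompact_Icc.exists_bound_of_continuousOn (hφ.continuousOn_iterate ha)
    refine ⟨C, ?_⟩
    rintro _ ⟨y, rfl⟩
    exact hC y.1 y.2
  refine (le_ciSup hb ⟨z, hz⟩).trans ?_
  exact le_ciSup (f := fun k : Fin (n + 1) => ⨆ z : Set.Icc (0:ℝ) 1, |dI^[(k : ℕ)] φ z.1|)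
    (Set.finite_range _).bddAbove ⟨a, by omega⟩

lemma C1dNorm_le {n : ℕ} {φ : ℝ → ℝ} {M : ℝ}
    (h : ∀ b ≤ n, ∀ z ∈ Set.Icc (0:ℝ) 1, |dI^[b] φ z| ≤ M) : C1dNorm n φ ≤ M := by
  have : Nonempty (Set.Icc (0:ℝ) 1) := ⟨⟨0, by simp⟩⟩
  exact ciSup_le fun k => ciSup_le fun z => h k (by omega) z.1 z.2

lemma IsCmKernel.abs_dI_iterate_kernelInt_le (hq : IsCmKernel m c q) {a : ℕ} (ha : a ≤ m)
    {φ : ℝ → ℝ} (hφ : MemC1d a φ) {M : ℝ}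
    (h : ∀ b ≤ a, ∀ z ∈ Set.Icc (0:ℝ) 1, |dI^[b] φ z| ≤ M) {z : ℝ}
    (hz : z ∈ Set.Icc (0:ℝ) 1) : |dI^[a] (kernelInt q φ) z| ≤ c a * M :=
  (abs_dI_iterate_le_C1dNorm le_rfl (hq.maps_to a ha φ hφ) hz).trans
    ((hq.norm_le a ha φ hφ).trans
      (mul_le_mul_of_nonneg_left (C1dNorm_le h) (hq.const_nonneg a ha)))

lemma IsCmKernel.abs_sub_sub_le (hq : IsCmKernel m c q) {a : ℕ} (ha : a ≤ m)
    {φ ψ χ : ℝ → ℝ} (hφ : MemC1d a φ) (hψ : MemC1d a ψ) (hχ : MemC1d a χ) (h M : ℝ)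
    (hM : ∀ b ≤ a, ∀ z ∈ Set.Icc (0:ℝ) 1,
      |dI^[b] φ z - dI^[b] ψ z - h * dI^[b] χ z| ≤ M) {z : ℝ} (hz : z ∈ Set.Icc (0:ℝ) 1) :
    |dI^[a] (kernelInt q φ) z - dI^[a] (kernelInt q ψ) z - h * dI^[a] (kernelInt q χ) z|
      ≤ c a * M := by
  have hu := hφ.add_mul hψ (-1)
  have hv := hu.add_mul hχ (-h)
  have key := hq.abs_dI_iterate_kernelInt_le ha hv (M := M) (fun b hb y hy => by
    rw [dI_iterate_add_mul hu hχ (-h) hb hy]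
    simp only
    rw [dI_iterate_add_mul hφ hψ (-1) hb hy]
    convert hM b hb y hy using 2
    ring) hz
  have hP : ∀ {ρ : ℝ → ℝ}, MemC1d a ρ → MemC1d a (kernelInt q ρ) := fun {ρ} => hq.maps_to a ha ρ
  rw [hq.kernelInt_add_mul hu.continuousOn hχ.continuousOn,
    hq.kernelInt_add_mul hφ.continuousOn hψ.continuousOn,
    dI_iterate_add_mul ((hP hφ).add_mul (hP hψ) (-1)) (hP hχ) (-h) le_rfl hz] at key
  simp only at key
  rw [dI_iterate_add_mul (hP hφ) (hP hψ) (-1) le_rfl hz] at key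
  convert key using 2
  ring

end KernelOperator

section CoordinateOperator

variable {d m : ℕ} {c : ℕ → ℝ} {q : ℝ → Measure ℝ}

/-- The kernel `q` acting in coordinate `k`. -/
def coordOp (k : Fin d) (q : ℝ → Measure ℝ) (f : (Fin d → ℝ) → ℝ) : (Fin d → ℝ) → ℝ :=
  fun x => ∫ y, f (Function.update x k y) ∂ q (x k)

lemma coordSlice_coordOp (k : Fin d) (x : Fin d → ℝ) (f : (Fin d → ℝ) → ℝ) :
    coordSlice k x (coordOp k q f) = kernelInt q (coordSlice k x f) := by
  funext t
  simp [coordSlice, coordOp, kernelInt]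

lemma pd_iterate_coordOp (k : Fin d) (a : ℕ) (x : Fin d → ℝ) (f : (Fin d → ℝ) → ℝ) :
    (pd d k)^[a] (coordOp k q f) x = dI^[a] (kernelInt q (coordSlice k x f)) (x k) := by
  rw [← coordSlice_coordOp, ← coordSlice_pd_iterate, coordSlice_apply_self]

lemma dI_iterate_coordSlice (k : Fin d) (b : ℕ) (x : Fin d → ℝ) (f : (Fin d → ℝ) → ℝ) (z : ℝ) :
    dI^[b] (coordSlice k x f) z = (pd d k)^[b] f (Function.update x k z) := by
  rw [← coordSlice_pd_iterate]
  rfl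

lemma IsCmKernel.coordOp_congr (hq : IsCmKernel m c q) (k : Fin d) {f g : (Fin d → ℝ) → ℝ}
    (h : Set.EqOn f g (cube d)) : Set.EqOn (coordOp k q f) (coordOp k q g) (cube d) :=
  fun _ hx => integral_congr_ae
    ((hq.ae_mem _).mono fun _ hy => h (update_mem_cube hx k hy))

lemma exists_uniform_modulus (g : ℕ → (Fin d → ℝ) → ℝ) (a : ℕ)
    (hg : ∀ b ≤ a, ContinuousOn (g b) (cube d)) {ε : ℝ} (hε : 0 < ε) :
    ∃ δ > 0, ∀ b ≤ a, ∀ y ∈ cube d, ∀ y' ∈ cube d, dist y y' < δ → |g b y - g b y'| < ε := by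
  have unif : ∀ b ≤ a, ∃ δ > 0, ∀ y ∈ cube d, ∀ y' ∈ cube d, dist y y' < δ →
      |g b y - g b y'| < ε := fun b hb =>
    Metric.uniformContinuousOn_iff.1 (isCompact_cube.uniformContinuousOn_of_continuous (hg b hb))
      ε hε
  induction a with
  | zero =>
    obtain ⟨δ, hδ, h⟩ := unif 0 le_rfl
    refine ⟨δ, hδ, fun b hb => ?_⟩
    obtain rfl : b = 0 := by omega
    exact h
  | succ a ih =>
    obtain ⟨δ, hδ, h⟩ := unif (a + 1) le_rfl
    obtain ⟨δ', hδ', h'⟩ := ih (fun b hb => hg b (by omega)) fun b hb => unif b (by omega)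
    refine ⟨min δ δ', lt_min hδ hδ', fun b hb y hy y' hy' hd => ?_⟩
    rcases Nat.lt_or_ge b (a + 1) with hlt | hge
    · exact h' b (by omega) y hy y' hy' (hd.trans_le (min_le_right _ _))
    · obtain rfl : b = a + 1 := by omega
      exact h y hy y' hy' (hd.trans_le (min_le_left _ _))

lemma IsCmKernel.continuousOn_pd_iterate_coordOp (hq : IsCmKernel m c q) (k : Fin d) {a : ℕ}
    (ha : a ≤ m) {f : (Fin d → ℝ) → ℝ} (hf : MemCm d a f) :
    ContinuousOn ((pd d k)^[a] (coordOp k q f)) (cube d) := by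
  refine Metric.continuousOn_iff.2 fun x hx ε hε => ?_
  have hc := hq.const_nonneg a ha
  set η := ε / 2 / (c a + 1) with hη
  have hη0 : 0 < η := by positivity
  have hηε : c a * η ≤ ε / 2 := by
    rw [hη, mul_div_assoc', div_le_iff₀ (by positivity)]
    nlinarith
  obtain ⟨δ, hδ, hmod⟩ := exists_uniform_modulus (fun b => (pd d k)^[b] f) a
    (fun b hb => (MemCm.partial_deriv_iterate (n := 0) (hf.mono (by omega)) k).continuousOn) hη0
  have hcont := (hq.maps_to a ha _ (hf.memC1d_coordSlice k hx)).continuousOn_iterate le_rfl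
  obtain ⟨δ', hδ', hcont⟩ := Metric.continuousOn_iff.1 hcont (x k) (mem_Icc_of_mem_cube hx k)
    (ε / 2) (by positivity)
  refine ⟨min δ δ', lt_min hδ hδ', fun y hy hd => ?_⟩
  have h1 := hcont (y k) (mem_Icc_of_mem_cube hy k)
    ((dist_le_pi_dist y x k).trans_lt (hd.trans_le (min_le_right _ _)))
  have h2 := hq.abs_sub_sub_le ha (hf.memC1d_coordSlice k hy) (hf.memC1d_coordSlice k hx)
    (hf.memC1d_coordSlice k hx) 0 η (fun b hb z hz => by
      rw [zero_mul, sub_zero, dI_iterate_coordSlice, dI_iterate_coordSlice]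
      exact (hmod b hb _ (update_mem_cube hy k hz) _ (update_mem_cube hx k hz)
        ((dist_update_update_le y x k z).trans_lt (hd.trans_le (min_le_left _ _)))).le)
    (mem_Icc_of_mem_cube hy k)
  rw [zero_mul, sub_zero] at h2
  rw [Real.dist_eq] at h1 ⊢
  rw [pd_iterate_coordOp, pd_iterate_coordOp]
  refine (abs_sub_le _ (dI^[a] (kernelInt q (coordSlice k x f)) (y k)) _).trans_lt ?_
  exact (add_lt_add_of_le_of_lt (h2.trans hηε) h1).trans_eq (by ring)

lemma IsCmKernel.hasDerivWithinAt_pd_iterate_coordOp (hq : IsCmKernel m c q) {k i : Fin d}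
    (hik : i ≠ k) {a : ℕ} (ha : a ≤ m) {f : (Fin d → ℝ) → ℝ} (hf : MemCm d (a + 1) f)
    {x : Fin d → ℝ} (hx : x ∈ cube d) :
    HasDerivWithinAt (coordSlice i x ((pd d k)^[a] (coordOp k q f)))
      ((pd d k)^[a] (coordOp k q (pd d i f)) x) (Set.Icc 0 1) (x i) := by
  rw [hasDerivWithinAt_iff_isLittleO, Asymptotics.isLittleO_iff]
  intro ε hε
  have hc := hq.const_nonneg a ha
  set η := ε / (c a + 1) with hη
  have hη0 : 0 < η := by positivity
  have hηε : c a * η ≤ ε := by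
    rw [hη, mul_div_assoc', div_le_iff₀ (by positivity)]
    nlinarith
  have hfb : ∀ b ≤ a, MemCm d 1 ((pd d k)^[b] f) := fun b hb =>
    MemCm.partial_deriv_iterate (hf.mono (by omega)) k
  obtain ⟨δ, hδ, hmod⟩ := exists_uniform_modulus (fun b => pd d i ((pd d k)^[b] f)) a
    (fun b hb => ((hfb b hb).partial_deriv i).continuousOn) hη0
  filter_upwards [self_mem_nhdsWithin, mem_nhdsWithin_of_mem_nhds (Metric.ball_mem_nhds (x i) hδ)]
    with t ht htδ
  rw [Metric.mem_ball, Real.dist_eq] at htδ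
  have hxt := update_mem_cube hx i ht
  have hfa : MemCm d a f := hf.of_succ
  have key := hq.abs_sub_sub_le ha (hfa.memC1d_coordSlice k hxt) (hfa.memC1d_coordSlice k hx)
    ((hf.partial_deriv i).memC1d_coordSlice k hx) (t - x i) (η * |t - x i|) (fun b hb z hz => by
      simp only [dI_iterate_coordSlice]
      have hxz := update_mem_cube hx k hz
      rw [← pd_pd_iterate_comm (hf.mono (by omega)) i k hxz]
      obtain ⟨ξ, hξ, hξt, e⟩ := exists_sub_eq_mul_dI
        ((hfb b hb).differentiableOn_coordSlice i hxz) (mem_Icc_of_mem_cube hx i) ht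
      have hxi : Function.update (Function.update x k z) i (x i) = Function.update x k z := by
        rw [Function.update_comm hik.symm, Function.update_eq_self]
      rw [← coordSlice_pd] at e
      simp only [coordSlice, hxi] at e
      rw [Function.update_comm hik, e, ← mul_sub, abs_mul, mul_comm]
      refine mul_le_mul_of_nonneg_right (hmod b hb _ (update_mem_cube hxz i hξ) _ hxz ?_).le
        (abs_nonneg _)
      refine (dist_update_self_le _ i ξ).trans_lt ?_
      rw [Function.update_of_ne hik]
      exact hξt.trans_lt htδ)
    (mem_Icc_of_mem_cube hx k)
  simp only [coordSlice_apply_self, smul_eq_mul, Real.norm_eq_abs]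
  have hSt : coordSlice i x ((pd d k)^[a] (coordOp k q f)) t
      = dI^[a] (kernelInt q (coordSlice k (Function.update x i t) f)) (x k) := by
    rw [coordSlice, pd_iterate_coordOp, Function.update_of_ne hik.symm]
  rw [hSt, pd_iterate_coordOp, pd_iterate_coordOp]
  refine key.trans ?_
  rw [← mul_assoc]
  exact mul_le_mul_of_nonneg_right hηε (abs_nonneg _)

lemma IsCmKernel.pd_pd_iterate_coordOp (hq : IsCmKernel m c q) {k i : Fin d}
    (hik : i ≠ k) {a : ℕ} (ha : a ≤ m) {f : (Fin d → ℝ) → ℝ} (hf : MemCm d (a + 1) f) :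
    Set.EqOn (pd d i ((pd d k)^[a] (coordOp k q f))) ((pd d k)^[a] (coordOp k q (pd d i f)))
      (cube d) := fun _ hx =>
  (hq.hasDerivWithinAt_pd_iterate_coordOp hik ha hf hx).derivWithin
    (uniqueDiffOn_Icc zero_lt_one _ (mem_Icc_of_mem_cube hx i))

lemma IsCmKernel.memCm_pd_iterate_coordOp (hq : IsCmKernel m c q) (k : Fin d) {n a : ℕ}
    (han : a + n ≤ m) {f : (Fin d → ℝ) → ℝ} (hf : MemCm d (a + n) f) :
    MemCm d n ((pd d k)^[a] (coordOp k q f)) := by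
  induction n generalizing a f with
  | zero => exact hq.continuousOn_pd_iterate_coordOp k han hf
  | succ n ih =>
    refine ⟨hq.continuousOn_pd_iterate_coordOp k (by omega) (hf.mono (by omega)), fun i => ?_⟩
    by_cases hik : i = k
    · subst hik
      refine ⟨fun x hx => ?_, ?_⟩
      · change DifferentiableWithinAt ℝ (coordSlice i x _) _ _
        rw [coordSlice_pd_iterate, coordSlice_coordOp]
        have h := hq.maps_to (a + 1) (by omega) _
          ((hf.mono (by omega) : MemCm d (a + 1) f).memC1d_coordSlice i hx)
        exact (MemC1d.iterate (n := 1) (b := a) (by rwa [add_comm])).2.1 _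
          (mem_Icc_of_mem_cube hx i)
      · have h := ih (a := a + 1) (by omega) (hf.mono (by omega))
        rwa [Function.iterate_succ_apply'] at h
    · have hf' : MemCm d (a + 1) f := hf.mono (by omega)
      refine ⟨fun x hx =>
        (hq.hasDerivWithinAt_pd_iterate_coordOp hik (by omega) hf' hx).differentiableWithinAt, ?_⟩
      exact (ih (by omega) (MemCm.partial_deriv (hf.mono (by omega)) i)).congr
        (hq.pd_pd_iterate_coordOp hik (by omega) hf').symm

lemma IsCmKernel.memCm_coordOp (hq : IsCmKernel m c q) (k : Fin d) {n : ℕ}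
    (hn : n ≤ m) {f : (Fin d → ℝ) → ℝ} (hf : MemCm d n f) : MemCm d n (coordOp k q f) :=
  hq.memCm_pd_iterate_coordOp k (a := 0) (by omega) (hf.mono (by omega))

lemma IsCmKernel.pd_iterate_coordOp_comm (hq : IsCmKernel m c q) {k i : Fin d} (hik : i ≠ k)
    {b : ℕ} {f : (Fin d → ℝ) → ℝ} (hf : MemCm d b f) :
    Set.EqOn ((pd d i)^[b] (coordOp k q f)) (coordOp k q ((pd d i)^[b] f)) (cube d) := by
  induction b generalizing f with
  | zero => exact fun _ _ => rfl
  | succ b ih =>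
    exact (pd_iterate_congr (hq.pd_pd_iterate_coordOp hik (a := 0) (by omega)
      (hf.mono (by omega))) i b).trans (ih (hf.partial_deriv i))

lemma IsCmKernel.abs_pd_iterate_coordOp_le (hq : IsCmKernel m c q) (k : Fin d) {a : ℕ}
    (ha : a ≤ m) {f : (Fin d → ℝ) → ℝ} (hf : MemCm d a f) {M : ℝ}
    (hM : ∀ b ≤ a, ∀ y ∈ cube d, |(pd d k)^[b] f y| ≤ M) {x : Fin d → ℝ} (hx : x ∈ cube d) :
    |(pd d k)^[a] (coordOp k q f) x| ≤ c a * M := by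
  rw [pd_iterate_coordOp]
  refine hq.abs_dI_iterate_kernelInt_le ha (hf.memC1d_coordSlice k hx) (fun b hb z hz => ?_)
    (mem_Icc_of_mem_cube hx k)
  rw [dI_iterate_coordSlice]
  exact hM b hb _ (update_mem_cube hx k hz)

end CoordinateOperator

section ProductOperator

variable {d m : ℕ} {c : ℕ → ℝ} {p : Fin d → ℝ → Measure ℝ}

/-- The kernels `p k`, `k ∈ L`, acting successively in their coordinates. -/
def listOp (p : Fin d → ℝ → Measure ℝ) (L : List (Fin d)) (f : (Fin d → ℝ) → ℝ) :
    (Fin d → ℝ) → ℝ :=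
  L.foldr (fun k g => coordOp k (p k) g) f

/-- The iterated partial derivative of order `α k` in each coordinate `k ∈ L`. -/
def listDeriv (α : Fin d → ℕ) (L : List (Fin d)) (f : (Fin d → ℝ) → ℝ) : (Fin d → ℝ) → ℝ :=
  L.foldr (fun i g => (pd d i)^[α i] g) f

lemma listDeriv_congr_fun (α : Fin d → ℕ) (L : List (Fin d)) {f g : (Fin d → ℝ) → ℝ}
    (h : Set.EqOn f g (cube d)) : Set.EqOn (listDeriv α L f) (listDeriv α L g) (cube d) := by
  induction L with
  | nil => exact h
  | cons k L ih => exact pd_iterate_congr ih k (α k)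

lemma listDeriv_update_of_notMem (α : Fin d → ℕ) {L : List (Fin d)} {k : Fin d} (hk : k ∉ L)
    (b : ℕ) (f : (Fin d → ℝ) → ℝ) :
    listDeriv (Function.update α k b) L f = listDeriv α L f := by
  induction L with
  | nil => rfl
  | cons i L ih =>
    rw [List.mem_cons, not_or] at hk
    change (pd d i)^[Function.update α k b i] (listDeriv _ L f) = (pd d i)^[α i] (listDeriv α L f)
    rw [ih hk.2, Function.update_of_ne (Ne.symm hk.1)]

lemma memCm_listDeriv {n : ℕ} (α : Fin d → ℕ) (L : List (Fin d)) {f : (Fin d → ℝ) → ℝ}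
    (hf : MemCm d (n + (L.map α).sum) f) : MemCm d n (listDeriv α L f) := by
  induction L generalizing n with
  | nil => exact hf
  | cons k L ih =>
    rw [List.map_cons, List.sum_cons, ← add_assoc] at hf
    exact MemCm.partial_deriv_iterate (ih hf) k

lemma pd_iterate_listDeriv_comm (α : Fin d → ℕ) (L : List (Fin d)) (k : Fin d) {b : ℕ}
    {f : (Fin d → ℝ) → ℝ} (hf : MemCm d (b + (L.map α).sum) f) :
    Set.EqOn ((pd d k)^[b] (listDeriv α L f)) (listDeriv α L ((pd d k)^[b] f)) (cube d) := by
  induction L with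
  | nil => exact fun _ _ => rfl
  | cons i L ih =>
    rw [List.map_cons, List.sum_cons, ← add_assoc] at hf
    exact (pd_iterate_comm (memCm_listDeriv α L hf) k i).trans
      (pd_iterate_congr (ih (hf.mono (by omega))) i (α i))

lemma listDeriv_coordOp_comm {q : ℝ → Measure ℝ} (hq : IsCmKernel m c q) (α : Fin d → ℕ)
    {L : List (Fin d)} {k : Fin d} (hk : k ∉ L) {f : (Fin d → ℝ) → ℝ}
    (hf : MemCm d (L.map α).sum f) :
    Set.EqOn (listDeriv α L (coordOp k q f)) (coordOp k q (listDeriv α L f)) (cube d) := by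
  induction L with
  | nil => exact fun _ _ => rfl
  | cons i L ih =>
    rw [List.mem_cons, not_or] at hk
    rw [List.map_cons, List.sum_cons] at hf
    exact (pd_iterate_congr (ih hk.2 (hf.mono (by omega))) i (α i)).trans
      (hq.pd_iterate_coordOp_comm (Ne.symm hk.1) (memCm_listDeriv α L hf))

lemma memCm_listOp (hp : ∀ k, IsCmKernel m c (p k)) (L : List (Fin d)) {n : ℕ} (hn : n ≤ m)
    {f : (Fin d → ℝ) → ℝ} (hf : MemCm d n f) : MemCm d n (listOp p L f) := by
  induction L with
  | nil => exact hf
  | cons k L ih => exact (hp k).memCm_coordOp k hn ih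

lemma pd_iterate_listOp_comm (hp : ∀ k, IsCmKernel m c (p k)) {L : List (Fin d)} {k : Fin d}
    (hk : k ∉ L) {b : ℕ} (hb : b ≤ m) {f : (Fin d → ℝ) → ℝ} (hf : MemCm d b f) :
    Set.EqOn ((pd d k)^[b] (listOp p L f)) (listOp p L ((pd d k)^[b] f)) (cube d) := by
  induction L with
  | nil => exact fun _ _ => rfl
  | cons i L ih =>
    rw [List.mem_cons, not_or] at hk
    exact ((hp i).pd_iterate_coordOp_comm hk.1 (memCm_listOp hp L hb hf)).trans
      ((hp i).coordOp_congr i (ih hk.2))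

lemma abs_listDeriv_listOp_le (hp : ∀ k, IsCmKernel m c (p k)) {L : List (Fin d)}
    (hL : L.Nodup) (α : Fin d → ℕ) (hα : (L.map α).sum ≤ m) {f : (Fin d → ℝ) → ℝ}
    (hf : MemCm d (L.map α).sum f) {M : ℝ}
    (hM : ∀ β : Fin d → ℕ, β ≤ α → ∀ y ∈ cube d, |listDeriv β L f y| ≤ M) :
    ∀ x ∈ cube d, |listDeriv α L (listOp p L f) x| ≤ (L.map fun k => c (α k)).prod * M := by
  induction L generalizing f with
  | nil => intro x hx; simpa [listOp] using hM α le_rfl x hx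
  | cons k L ih =>
    intro x hx
    obtain ⟨hkL, hL⟩ := List.nodup_cons.1 hL
    rw [List.map_cons, List.sum_cons] at hf hα
    have hTf := memCm_listOp hp L hα hf
    have e : listDeriv α (k :: L) (listOp p (k :: L) f) x
        = (pd d k)^[α k] (coordOp k (p k) (listDeriv α L (listOp p L f))) x :=
      pd_iterate_congr (listDeriv_coordOp_comm (hp k) α hkL (hTf.mono (by omega))) k (α k) hx
    rw [e, List.map_cons, List.prod_cons, mul_assoc]
    refine (hp k).abs_pd_iterate_coordOp_le k (by omega) (memCm_listDeriv α L hTf)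
      (fun b hb y hy => ?_) hx
    rw [pd_iterate_listDeriv_comm α L k (hTf.mono (by omega)) hy,
      listDeriv_congr_fun α L (pd_iterate_listOp_comm hp hkL (by omega) (hf.mono (by omega))) hy]
    refine ih hL (by omega) (MemCm.partial_deriv_iterate (hf.mono (by omega)) k)
      (fun β hβ z hz => ?_) y hy
    have hsum : (L.map β).sum ≤ (L.map α).sum := List.sum_le_sum fun i _ => hβ i
    rw [← pd_iterate_listDeriv_comm β L k (hf.mono (by omega)) hz]
    have h := hM (Function.update β k b) (by
      intro i
      by_cases hi : i = k
      · subst hi; simpa using hb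
      · simpa [hi] using hβ i) z hz
    change |(pd d k)^[Function.update β k b k] (listDeriv (Function.update β k b) L f) z| ≤ M at h
    rwa [Function.update_self, listDeriv_update_of_notMem β hkL] at h

lemma measurePreserving_update (μ : Fin d → Measure ℝ) [∀ k, IsProbabilityMeasure (μ k)]
    (k : Fin d) :
    MeasurePreserving (fun w : ℝ × (Fin d → ℝ) => Function.update w.2 k w.1)
      ((μ k).prod (Measure.pi μ)) (Measure.pi μ) := by
  have hm : Measurable fun w : ℝ × (Fin d → ℝ) => Function.update w.2 k w.1 := by
    refine measurable_pi_lambda _ fun i => ?_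
    by_cases h : i = k
    · subst h; simpa using measurable_fst
    · simp only [Function.update_of_ne h]
      exact (measurable_pi_apply i).comp measurable_snd
  refine ⟨hm, (Measure.pi_eq fun s hs => ?_).symm⟩
  rw [Measure.map_apply hm (MeasurableSet.univ_pi hs)]
  have hpre : (fun w : ℝ × (Fin d → ℝ) => Function.update w.2 k w.1) ⁻¹' Set.univ.pi s
      = s k ×ˢ Set.univ.pi (Function.update s k Set.univ) := by
    ext w
    simp only [Set.mem_preimage, Set.mem_univ_pi, Set.mem_prod]
    constructor
    · refine fun h => ⟨by simpa using h k, fun i => ?_⟩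
      by_cases hi : i = k
      · subst hi; simp
      · simpa [hi] using h i
    · rintro ⟨h0, h⟩ i
      by_cases hi : i = k
      · subst hi; simpa using h0
      · simpa [hi] using h i
  rw [hpre, Measure.prod_prod, Measure.pi_pi, ← Finset.mul_prod_erase _ _ (Finset.mem_univ k),
    ← Finset.mul_prod_erase _ (fun i => μ i (s i)) (Finset.mem_univ k)]
  rw [Function.update_self, measure_univ, one_mul]
  congr 1
  refine Finset.prod_congr rfl fun i hi => ?_
  rw [Function.update_of_ne (Finset.ne_of_mem_erase hi)]

lemma listOp_eq_integral_pi (μ : Fin d → Measure ℝ) [∀ k, IsProbabilityMeasure (μ k)]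
    {f : (Fin d → ℝ) → ℝ} (hfm : Measurable f) {C : ℝ} (hC : ∀ x, |f x| ≤ C)
    {L : List (Fin d)} (hL : L.Nodup) (x : Fin d → ℝ) (hx : ∀ i ∈ L, p i (x i) = μ i) :
    listOp p L f x = ∫ y, f (fun i => if i ∈ L then y i else x i) ∂ Measure.pi μ := by
  induction L generalizing x with
  | nil => simp [listOp]
  | cons k L ih =>
    obtain ⟨hkL, hL⟩ := List.nodup_cons.1 hL
    have hmeas : Measurable fun y : Fin d → ℝ => f fun i => if i ∈ k :: L then y i else x i := by
      refine hfm.comp (measurable_pi_lambda _ fun i => ?_)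
      by_cases hi : i ∈ k :: L
      · simpa only [hi, if_true] using measurable_pi_apply i
      · simpa only [hi, if_false] using measurable_const
    have hmp := measurePreserving_update μ k
    have hF_int : Integrable (fun y : Fin d → ℝ => f fun i => if i ∈ k :: L then y i else x i)
        (Measure.pi μ) :=
      Integrable.of_bound hmeas.aestronglyMeasurable C (ae_of_all _ fun _ => hC _)
    rw [← hmp.map_eq, integral_map hmp.measurable.aemeasurable hmeas.aestronglyMeasurable,
      integral_prod (fun w : ℝ × (Fin d → ℝ) =>
        f fun i => if i ∈ k :: L then Function.update w.2 k w.1 i else x i)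
        (hmp.integrable_comp_of_integrable hF_int)]
    change ∫ z, listOp p L f (Function.update x k z) ∂ p k (x k) = _
    rw [hx k List.mem_cons_self]
    refine integral_congr_ae (ae_of_all _ fun z => ?_)
    simp only
    rw [ih hL (Function.update x k z) fun i hi => ?_]
    · refine integral_congr_ae (ae_of_all _ fun y => ?_)
      simp only
      congr 1
      funext i
      by_cases hi : i = k
      · subst hi; simp [hkL]
      · simp [hi]
    · rw [Function.update_of_ne (ne_of_mem_of_not_mem hi hkL)]
      exact hx i (List.mem_cons_of_mem k hi)

lemma listOp_congr (hp : ∀ k, IsCmKernel m c (p k)) (L : List (Fin d)) {f g : (Fin d → ℝ) → ℝ}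
    (h : Set.EqOn f g (cube d)) : Set.EqOn (listOp p L f) (listOp p L g) (cube d) := by
  induction L with
  | nil => exact h
  | cons k L ih => exact (hp k).coordOp_congr k ih

lemma listOp_finRange_eqOn (hp : ∀ k, IsCmKernel m c (p k)) {f : (Fin d → ℝ) → ℝ}
    (hf : ContinuousOn f (cube d)) :
    Set.EqOn (listOp p (List.finRange d) f)
      (fun x => ∫ y, f y ∂ Measure.pi fun k => p k (x k)) (cube d) := by
  intro x hx
  have hprob : ∀ k, IsProbabilityMeasure (p k (x k)) := fun k => (hp k).isProbabilityMeasure _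
  have hind : Set.EqOn f ((cube d).indicator f) (cube d) := (Set.eqOn_indicator).symm
  have hfm : Measurable ((cube d).indicator f) := by
    classical
    rw [← Set.piecewise_eq_indicator]
    exact hf.measurable_piecewise continuousOn_const measurableSet_cube
  obtain ⟨C, hC⟩ := isCompact_cube.exists_bound_of_continuousOn hf
  have hC' : ∀ y, |(cube d).indicator f y| ≤ C := by
    intro y
    by_cases hy : y ∈ cube d
    · rw [Set.indicator_of_mem hy]; exact hC y hy
    · rw [Set.indicator_of_notMem hy, abs_zero]
      exact (norm_nonneg _).trans (hC 0 zero_mem_cube)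
  rw [listOp_congr hp _ hind hx, listOp_eq_integral_pi (fun k => p k (x k)) hfm hC'
    (List.nodup_finRange d) x fun _ _ => rfl]
  refine integral_congr_ae ?_
  have hae : ∀ᵐ y ∂ Measure.pi fun k => p k (x k), y ∈ cube d := by
    have : ∀ᵐ y ∂ Measure.pi fun k => p k (x k), ∀ i, y i ∈ Set.Icc (0:ℝ) 1 :=
      ae_all_iff.2 fun i => (Measure.tendsto_eval_ae_ae (i := i)).eventually ((hp i).ae_mem (x i))
    exact this.mono fun y hy i _ => hy i
  filter_upwards [hae] with y hy
  simp [Set.indicator_of_mem hy]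

end ProductOperator

section CmNorm

variable {d : ℕ}

lemma MemCm.abs_mderiv_le_CmNorm {n : ℕ} {f : (Fin d → ℝ) → ℝ} (hf : MemCm d n f)
    {α : Fin d → ℕ} (hα : ∑ i, α i ≤ n) {x : Fin d → ℝ} (hx : x ∈ cube d) :
    |mderiv d α f x| ≤ CmNorm d n f := by
  have hcont : ContinuousOn (mderiv d α f) (cube d) := by
    rw [Fin.sum_univ_def] at hα
    exact (memCm_listDeriv (n := 0) α (List.finRange d) (hf.mono (by omega))).continuousOn
  have hb : BddAbove (Set.range fun x : cube d => |mderiv d α f x.1|) := by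
    obtain ⟨C, hC⟩ := isCompact_cube.exists_bound_of_continuousOn hcont
    refine ⟨C, ?_⟩
    rintro _ ⟨y, rfl⟩
    exact hC y.1 y.2
  have hfin : Finite {α : Fin d → ℕ // ∑ i, α i ≤ n} := by
    refine Finite.of_injective (β := Fin d → Fin (n + 1)) (fun α i => ⟨α.1 i, ?_⟩) ?_
    · exact Nat.lt_succ_of_le ((Finset.single_le_sum (f := α.1) (fun _ _ => Nat.zero_le _)
        (Finset.mem_univ i)).trans α.2)
    · intro α β h
      ext i
      simpa using congrArg Fin.val (congrFun h i)
  refine (le_ciSup hb ⟨x, hx⟩).trans ?_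
  exact le_ciSup (f := fun α : {α : Fin d → ℕ // ∑ i, α i ≤ n} => supCube d (mderiv d α.1 f))
    (Set.finite_range _).bddAbove ⟨α, hα⟩

lemma CmNorm_le {n : ℕ} {f : (Fin d → ℝ) → ℝ} {M : ℝ}
    (h : ∀ α : Fin d → ℕ, ∑ i, α i ≤ n → ∀ x ∈ cube d, |mderiv d α f x| ≤ M) :
    CmNorm d n f ≤ M := by
  have : Nonempty {α : Fin d → ℕ // ∑ i, α i ≤ n} := ⟨⟨0, by simp⟩⟩
  have : Nonempty (cube d) := ⟨⟨0, zero_mem_cube⟩⟩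
  exact ciSup_le fun α => ciSup_le fun x => h α.1 α.2 x.1 x.2

/-- At most one coordinate of a multi-index of order at most three is larger than one. -/
lemma prod_const_le {c : ℕ → ℝ} (hc0 : c 0 = 1) (hc1 : c 1 = 1) (hc2 : 1 ≤ c 2)
    (hc23 : c 2 ≤ c 3) {m : ℕ} (hm : m ≤ 3) {α : Fin d → ℕ} (hα : ∑ i, α i ≤ m) :
    ∏ k, c (α k) ≤ c m := by
  have hsmall : ∀ l, l ≤ 1 → c l = 1 := by
    intro l hl
    interval_cases l <;> assumption
  by_cases h : ∀ k, α k ≤ 1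
  · rw [Finset.prod_eq_one fun k _ => hsmall _ (h k)]
    interval_cases m <;> linarith
  · push Not at h
    obtain ⟨k, hk⟩ := h
    have hsplit := Finset.add_sum_erase Finset.univ α (Finset.mem_univ k)
    have hkm : α k ≤ m := by omega
    rw [Finset.prod_eq_single_of_mem k (Finset.mem_univ k) fun i _ hi => hsmall _ (by
      have : α i ≤ ∑ j ∈ Finset.univ.erase k, α j :=
        Finset.single_le_sum (f := α) (fun _ _ => Nat.zero_le _)
          (Finset.mem_erase.2 ⟨hi, Finset.mem_univ i⟩)
      omega)]
    generalize α k = a at hk hkm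
    interval_cases m <;> interval_cases a <;> linarith

end CmNorm

/-- `C^m`-estimate for the multidimensional diffusive part: if each kernel `p^k` maps
`C^{m'}([0,1],ℝ)` into itself with operator norm at most `c_{m'}` for all `m' ≤ m`
(where `c₀ = c₁ = 1 ≤ c₂ ≤ c₃`), then `T²` maps `C^m([0,1]^d,ℝ)` into itself and
`‖T²f‖_{C^m} ≤ c_m ‖f‖_{C^m}`. -/
theorem Cm_estimate_product_kernel
    (d : ℕ) (hd : 0 < d) (m : ℕ) (hm : m ≤ 3)
    (c : ℕ → ℝ) (hc0 : c 0 = 1) (hc1 : c 1 = 1) (hc2 : 1 ≤ c 2) (hc23 : c 2 ≤ c 3)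
    (p : Fin d → ℝ → Measure ℝ)
    [∀ k z, IsProbabilityMeasure (p k z)]
    (hmeas : ∀ k : Fin d, Measurable (p k))
    (hsupp : ∀ k : Fin d, ∀ z, p k z (Set.Icc (0:ℝ) 1)ᶜ = 0)
    (hp : ∀ k : Fin d, ∀ m' ≤ m, ∀ φ : ℝ → ℝ, MemC1d m' φ →
      MemC1d m' (fun z => ∫ y, φ y ∂ p k z) ∧
      C1dNorm m' (fun z => ∫ y, φ y ∂ p k z) ≤ c m' * C1dNorm m' φ)
    (f : (Fin d → ℝ) → ℝ) (hf : MemCm d m f) :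
    MemCm d m (fun x : Fin d → ℝ => ∫ y, f y ∂ Measure.pi (fun k => p k (x k))) ∧
    CmNorm d m (fun x : Fin d → ℝ => ∫ y, f y ∂ Measure.pi (fun k => p k (x k))) ≤
      c m * CmNorm d m f := by
  have hcnn : ∀ m' ≤ m, 0 ≤ c m' := by
    intro m' hm'
    have : m' ≤ 3 := hm'.trans hm
    interval_cases m' <;> linarith
  have hker : ∀ k, IsCmKernel m c (p k) := fun k =>
    ⟨fun _ => inferInstance, hsupp k, hcnn, fun m' hm' φ hφ => (hp k m' hm' φ hφ).1,
      fun m' hm' φ hφ => (hp k m' hm' φ hφ).2⟩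
  have heq := listOp_finRange_eqOn hker hf.continuousOn
  refine ⟨(memCm_listOp hker _ le_rfl hf).congr heq, CmNorm_le fun α hα x hx => ?_⟩
  have hnn : 0 ≤ CmNorm d m f := (abs_nonneg _).trans (hf.abs_mderiv_le_CmNorm hα hx)
  have hα' : ((List.finRange d).map α).sum ≤ m := by rwa [← Fin.sum_univ_def]
  have h := abs_listDeriv_listOp_le hker (List.nodup_finRange d) α hα' (hf.mono hα')
    (M := CmNorm d m f) (fun β hβ y hy => hf.abs_mderiv_le_CmNorm
      ((Finset.sum_le_sum fun i _ => hβ i).trans hα) hy) x hx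
  rw [← Fin.prod_univ_def, listDeriv_congr_fun α _ heq hx] at h
  exact h.trans (mul_le_mul_of_nonneg_right (prod_const_le hc0 hc1 hc2 hc23 hm hα) hnn)

end
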